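/- Sufficient condition for normality (ii): with the Hartwig–Spindelböck decomposition data as in the context and Â^N := Û · fromBlocks(K*Σ₁⁻¹, 0, L*Σ₁⁻¹, 0) · Û* (the NDMPI of Â), if Â^N·Â*·Â = Â*, then Â is normal (Â·Â* = Â*·Â). -/

import Mathlib

open Matrix

/-- The dual complex numbers `𝔻ℂ := ℂ[ε]`, the trivial square-zero extension of `ℂ` by `ℂ`. -/
abbrev DC := TrivSqZeroExt ℂ ℂ

/-- Star on dual complex numbers: `(a + b·ε)* = conj a + conj b · ε`. -/
instance : Star DC :=
  ⟨fun x => ((starRingEnd ℂ) x.fst, (starRingEnd ℂ) x.snd)⟩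

/-- A positive appreciable real dual number: the standard part is a positive real and
the dual part is real. -/
def PosAppreciable (x : DC) : Prop :=
  (∃ a : ℝ, 0 < a ∧ x.fst = (a : ℂ)) ∧ (∃ b : ℝ, x.snd = (b : ℂ))

/-- A nonnegative infinitesimal real dual number: the standard part is `0` and
the dual part is a nonnegative real. -/
def NonnegInfinitesimal (x : DC) : Prop :=
  x.fst = 0 ∧ ∃ b : ℝ, 0 ≤ b ∧ x.snd = (b : ℂ)

/-- The standard part of a dual complex matrix. -/
def stdPart {m n : Type*} (X : Matrix m n DC) : Matrix m n ℂ :=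
  X.map TrivSqZeroExt.fst

/-- The dual part of a dual complex matrix. -/
def dualPart {m n : Type*} (X : Matrix m n DC) : Matrix m n ℂ :=
  X.map TrivSqZeroExt.snd

/-- Dual complex numbers form a star ring, the involution being coefficientwise conjugation. -/
instance : StarRing DC where
  star_involutive x := by
    refine TrivSqZeroExt.ext ?_ ?_
    · exact Complex.conj_conj x.fst
    · exact Complex.conj_conj x.snd
  star_mul x y := by
    refine TrivSqZeroExt.ext ?_ ?_
    · change (starRingEnd ℂ) (x * y).fst = (starRingEnd ℂ) y.fst * (starRingEnd ℂ) x.fst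
      simp [mul_comm]
    · change (starRingEnd ℂ) (x * y).snd =
        (starRingEnd ℂ) y.fst * (starRingEnd ℂ) x.snd +
          (starRingEnd ℂ) y.snd * (starRingEnd ℂ) x.fst
      simp [mul_comm, add_comm]
  star_add x y := by
    refine TrivSqZeroExt.ext ?_ ?_
    · exact map_add (starRingEnd ℂ) x.fst y.fst
    · exact map_add (starRingEnd ℂ) x.snd y.snd

/-- A dual complex number with real standard and dual parts is self-adjoint. -/
theorem DC.star_eq_self {x : DC} (hf : ∃ a : ℝ, x.fst = a) (hs : ∃ b : ℝ, x.snd = b) :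
    star x = x := by
  obtain ⟨a, ha⟩ := hf
  obtain ⟨b, hb⟩ := hs
  refine TrivSqZeroExt.ext ?_ ?_
  · change (starRingEnd ℂ) x.fst = x.fst
    rw [ha, Complex.conj_ofReal]
  · change (starRingEnd ℂ) x.snd = x.snd
    rw [hb, Complex.conj_ofReal]

theorem PosAppreciable.star_eq_self {x : DC} (hx : PosAppreciable x) : star x = x :=
  DC.star_eq_self (hx.1.imp fun _ h => h.2) hx.2

theorem NonnegInfinitesimal.star_eq_self {x : DC} (hx : NonnegInfinitesimal x) : star x = x :=
  DC.star_eq_self ⟨0, by simpa using hx.1⟩ (hx.2.imp fun _ h => h.2)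

theorem PosAppreciable.isUnit {x : DC} (hx : PosAppreciable x) : IsUnit x := by
  obtain ⟨⟨a, ha, hxa⟩, -⟩ := hx
  rw [TrivSqZeroExt.isUnit_iff_isUnit_fst, hxa]
  simpa using ha.ne'

section StarRing

variable {R m n : Type*} [CommRing R] [StarRing R] [Fintype m] [DecidableEq m] [Fintype n]
  [DecidableEq n]

/-- Normality criterion for `D * W` with `D = diag(S, T)` self-adjoint, `S` invertible and `W`
unitary. -/
theorem normal_fromBlocks_mul_of_isUnit {S : Matrix m m R} {T : Matrix n n R}
    {W : Matrix (m ⊕ n) (m ⊕ n) R} (hS : IsUnit S.det) (hSH : Sᴴ = S) (hTH : Tᴴ = T)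
    (hW₁ : W * Wᴴ = 1)
    (h : Wᴴ * fromBlocks S⁻¹ 0 0 0 * (fromBlocks S 0 0 T * W)ᴴ * (fromBlocks S 0 0 T * W) =
      (fromBlocks S 0 0 T * W)ᴴ) :
    fromBlocks S 0 0 T * W * (fromBlocks S 0 0 T * W)ᴴ =
      (fromBlocks S 0 0 T * W)ᴴ * (fromBlocks S 0 0 T * W) := by
  have hDH : (fromBlocks S 0 0 T)ᴴ = fromBlocks S 0 0 T := by
    simp [fromBlocks_conjTranspose, hSH, hTH]
  rw [conjTranspose_mul, hDH] at h ⊢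
  have key : fromBlocks S⁻¹ 0 0 0 * (Wᴴ * fromBlocks S 0 0 T * (fromBlocks S 0 0 T * W)) =
      fromBlocks S 0 0 T := by
    have := congrArg (W * ·) h
    simpa only [← Matrix.mul_assoc, hW₁, Matrix.one_mul] using this
  have hT : T = 0 := by
    have := congrArg toBlocks₂₂ key
    rw [← fromBlocks_toBlocks (Wᴴ * fromBlocks S 0 0 T * (fromBlocks S 0 0 T * W)),
      fromBlocks_multiply] at this
    simpa using this.symm
  subst hT
  obtain ⟨K, L, M, N, rfl⟩ : ∃ K L M N, W = fromBlocks K L M N :=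
    ⟨_, _, _, _, (fromBlocks_toBlocks W).symm⟩
  simp only [fromBlocks_conjTranspose, fromBlocks_multiply, Matrix.mul_zero, Matrix.zero_mul,
    add_zero, fromBlocks_inj, and_true] at key
  obtain ⟨hK, hL⟩ := key
  have hK : Kᴴ * S * (S * K) = S * S := by
    rw [← Matrix.mul_nonsing_inv_cancel_left S (Kᴴ * S * (S * K)) hS, hK]
  have hL : Kᴴ * S * (S * L) = 0 := by
    rw [← Matrix.mul_nonsing_inv_cancel_left S (Kᴴ * S * (S * L)) hS, hL, Matrix.mul_zero]
  have hKS : IsUnit (Kᴴ * S).det := by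
    have h' := congrArg det hK
    rw [det_mul, det_mul S S] at h'
    exact isUnit_of_mul_isUnit_left (h' ▸ hS.mul hS)
  have hL : L = 0 := by
    rw [← Matrix.nonsing_inv_mul_cancel_left S L hS,
      ← Matrix.nonsing_inv_mul_cancel_left (Kᴴ * S) (S * L) hKS, hL]
    simp
  subst hL
  have hDD : fromBlocks S 0 0 (0 : Matrix n n R) * fromBlocks K 0 M N *
      ((fromBlocks K 0 M N)ᴴ * fromBlocks S 0 0 0) = fromBlocks (S * S) 0 0 0 := by
    rw [Matrix.mul_assoc, ← Matrix.mul_assoc (fromBlocks K 0 M N), hW₁, Matrix.one_mul]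
    simp [fromBlocks_multiply]
  rw [hDD]
  simp [fromBlocks_conjTranspose, fromBlocks_multiply, hK]

end StarRing

/-- Sufficient condition for normality (ii). -/
theorem normal_of_ndmpi_conjTranspose_mul
    {r s : ℕ}
    -- `Û`, a unitary matrix
    (U : Matrix (Fin r ⊕ Fin s) (Fin r ⊕ Fin s) DC)
    (hU₁ : U * Uᴴ = 1) (hU₂ : Uᴴ * U = 1)
    -- the blocks `K, L, M, N` forming a unitary block matrix
    (K : Matrix (Fin r) (Fin r) DC) (L : Matrix (Fin r) (Fin s) DC)
    (M : Matrix (Fin s) (Fin r) DC) (N : Matrix (Fin s) (Fin s) DC)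
    (hW₁ : fromBlocks K L M N * (fromBlocks K L M N)ᴴ = 1)
    (hW₂ : (fromBlocks K L M N)ᴴ * fromBlocks K L M N = 1)
    -- `Σ₁` diagonal with positive appreciable real dual diagonal entries
    (S₁ : Matrix (Fin r) (Fin r) DC) (d₁ : Fin r → DC)
    (hS₁ : S₁ = Matrix.diagonal d₁) (hd₁ : ∀ i, PosAppreciable (d₁ i))
    -- `Σ₂` diagonal with nonnegative infinitesimal real dual diagonal entries
    (S₂ : Matrix (Fin s) (Fin s) DC) (d₂ : Fin s → DC)
    (hS₂ : S₂ = Matrix.diagonal d₂) (hd₂ : ∀ i, NonnegInfinitesimal (d₂ i))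
    -- the Hartwig–Spindelböck decomposition of `Â`
    (A : Matrix (Fin r ⊕ Fin s) (Fin r ⊕ Fin s) DC)
    (hA : A = U * fromBlocks (S₁ * K) (S₁ * L) (S₂ * M) (S₂ * N) * Uᴴ)
    -- `Â^N`, the NDMPI of `Â`
    (AN : Matrix (Fin r ⊕ Fin s) (Fin r ⊕ Fin s) DC)
    (hAN : AN = U * fromBlocks (Kᴴ * S₁⁻¹) 0 (Lᴴ * S₁⁻¹) 0 * Uᴴ)
    (h : AN * Aᴴ * A = Aᴴ) :
    A * Aᴴ = Aᴴ * A := by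
  have hS₁u : IsUnit S₁.det := by
    rw [hS₁, det_diagonal]
    exact IsUnit.prod_univ_iff.mpr fun i => (hd₁ i).isUnit
  have hS₁H : S₁ᴴ = S₁ := by
    rw [hS₁, diagonal_conjTranspose]
    exact congrArg diagonal (funext fun i => (hd₁ i).star_eq_self)
  have hS₂H : S₂ᴴ = S₂ := by
    rw [hS₂, diagonal_conjTranspose]
    exact congrArg diagonal (funext fun i => (hd₂ i).star_eq_self)
  have hB : fromBlocks (S₁ * K) (S₁ * L) (S₂ * M) (S₂ * N) =
      fromBlocks S₁ 0 0 S₂ * fromBlocks K L M N := by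
    simp [fromBlocks_multiply]
  have hC : fromBlocks (Kᴴ * S₁⁻¹) 0 (Lᴴ * S₁⁻¹) 0 =
      (fromBlocks K L M N)ᴴ * fromBlocks S₁⁻¹ 0 0 (0 : Matrix (Fin s) (Fin s) DC) := by
    simp [fromBlocks_conjTranspose, fromBlocks_multiply]
  rw [hB] at hA
  rw [hC] at hAN
  have hAH : Aᴴ = U * (fromBlocks S₁ 0 0 S₂ * fromBlocks K L M N)ᴴ * Uᴴ := by
    rw [hA]
    simp only [conjTranspose_mul, conjTranspose_conjTranspose, Matrix.mul_assoc]
  have conj_mul (X Y : Matrix (Fin r ⊕ Fin s) (Fin r ⊕ Fin s) DC) :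
      U * X * Uᴴ * (U * Y * Uᴴ) = U * (X * Y) * Uᴴ := by
    rw [show U * X * Uᴴ * (U * Y * Uᴴ) = U * X * (Uᴴ * U) * Y * Uᴴ by
      simp only [Matrix.mul_assoc], hU₂, Matrix.mul_one, Matrix.mul_assoc U]
  have conj_inj {X Y : Matrix (Fin r ⊕ Fin s) (Fin r ⊕ Fin s) DC}
      (hXY : U * X * Uᴴ = U * Y * Uᴴ) : X = Y := by
    have := congrArg (Uᴴ * · * U) hXY
    simpa only [Matrix.mul_assoc, hU₂, Matrix.mul_one, ← Matrix.mul_assoc Uᴴ U,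
      Matrix.one_mul] using this
  rw [hAH, hAN, hA, conj_mul, conj_mul] at h
  rw [hAH, hA, conj_mul, conj_mul,
    normal_fromBlocks_mul_of_isUnit hS₁u hS₁H hS₂H hW₁ (conj_inj h)]
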